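/- Let u be a Schwartz function on ℝ with values in ℂ such that its Fourier transform 𝓕u has compact support. Then for every complex number a and every real τ, the series ∑_{n=0}^∞ (aⁿ/n!) · u⁽ⁿ⁾(τ) (where u⁽ⁿ⁾ is the n-th iterated derivative) converges absolutely, and its sum equals ∫_ℝ exp(2πi (τ + a) ξ) · 𝓕u(ξ) dξ. -/

import Mathlib

open FourierTransform Real MeasureTheory

theorem SchwartzMap.coe_iterate_derivCLM (u : SchwartzMap ℝ ℂ) (n : ℕ) :
    ⇑((SchwartzMap.derivCLM ℂ ℂ)^[n] u) = iteratedDeriv n (⇑u) := by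
  induction n with
  | zero => simp
  | succ n ih =>
    rw [iteratedDeriv_succ, ← ih, Function.iterate_succ_apply']
    rfl

theorem SchwartzMap.integrable_iteratedDeriv (u : SchwartzMap ℝ ℂ) (n : ℕ) :
    Integrable (iteratedDeriv n (⇑u)) := by
  rw [← u.coe_iterate_derivCLM]
  exact SchwartzMap.integrable _

/-- Derivatives of a Schwartz function, recovered from its Fourier transform. -/
theorem SchwartzMap.iteratedDeriv_eq_integral_fourier (u : SchwartzMap ℝ ℂ) (n : ℕ) (τ : ℝ) :
    iteratedDeriv n (⇑u) τ = ∫ ξ : ℝ, Complex.exp (2 * (π : ℂ) * Complex.I * τ * ξ) *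
      ((2 * (π : ℂ) * Complex.I * ξ) ^ n * 𝓕 (⇑u) ξ) := by
  have hF : 𝓕 (iteratedDeriv n (⇑u)) =
      fun ξ : ℝ ↦ (2 * (π : ℂ) * Complex.I * ξ) ^ n • 𝓕 (⇑u) ξ :=
    Real.fourier_iteratedDeriv (N := ⊤) (u.smooth ⊤)
      (fun m _ ↦ u.integrable_iteratedDeriv m) le_top
  have hint : Integrable (𝓕 (iteratedDeriv n (⇑u))) := by
    rw [← u.coe_iterate_derivCLM, ← SchwartzMap.fourier_coe]
    exact SchwartzMap.integrable _
  have hcont : Continuous (iteratedDeriv n (⇑u)) := by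
    rw [← u.coe_iterate_derivCLM]
    exact SchwartzMap.continuous _
  rw [← congrFun (hcont.fourierInv_fourier_eq (u.integrable_iteratedDeriv n) hint) τ,
    Real.fourierInv_eq', hF]
  refine integral_congr_ae (.of_forall fun ξ ↦ ?_)
  simp only [smul_eq_mul, RCLike.inner_apply, conj_trivial]
  push_cast
  ring_nf

/-- A compactly supported continuous function may be integrated termwise against the
exponential series in one factor. -/
theorem hasSum_integral_exp_mul_of_hasCompactSupport {g : ℝ → ℂ} (hg : Continuous g)
    (hsupp : HasCompactSupport g) (c : ℂ) :
    HasSum (fun n : ℕ ↦ ∫ ξ : ℝ, (c * ξ) ^ n / (n.factorial : ℂ) * g ξ)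
      (∫ ξ : ℝ, Complex.exp (c * ξ) * g ξ) := by
  have hb (ξ : ℝ) : HasSum (fun n : ℕ ↦ ‖c * ξ‖ ^ n / (n.factorial : ℝ) * ‖g ξ‖)
      (Real.exp ‖c * ξ‖ * ‖g ξ‖) := by
    rw [Real.exp_eq_exp_ℝ]
    exact (NormedSpace.expSeries_div_hasSum_exp ‖c * ξ‖).mul_right ‖g ξ‖
  refine hasSum_integral_of_dominated_convergence
    (fun n ξ ↦ ‖c * ξ‖ ^ n / (n.factorial : ℝ) * ‖g ξ‖) (fun n ↦ ?_)
    (fun n ↦ .of_forall fun ξ ↦ ?_) (.of_forall fun ξ ↦ (hb ξ).summable) ?_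
    (.of_forall fun ξ ↦ ?_)
  · exact Continuous.aestronglyMeasurable (by fun_prop)
  · simp
  · simp_rw [fun ξ ↦ (hb ξ).tsum_eq]
    exact Continuous.integrable_of_hasCompactSupport (by fun_prop) hsupp.norm.mul_left
  · rw [Complex.exp_eq_exp_ℂ]
    exact (NormedSpace.expSeries_div_hasSum_exp (c * ξ)).mul_right (g ξ)

theorem stmt3 (u : SchwartzMap ℝ ℂ)
    (hsupp : HasCompactSupport (𝓕 (⇑u))) (a : ℂ) (τ : ℝ) :
    Summable (fun n : ℕ => ‖(a ^ n / (n.factorial : ℂ)) * iteratedDeriv n (⇑u) τ‖) ∧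
    ∑' n : ℕ, (a ^ n / (n.factorial : ℂ)) * iteratedDeriv n (⇑u) τ
      = ∫ ξ : ℝ, Complex.exp (2 * (π : ℂ) * Complex.I * ((τ : ℂ) + a) * (ξ : ℂ)) *
          𝓕 (⇑u) ξ := by
  have hcont : Continuous (𝓕 (⇑u)) := by
    rw [← SchwartzMap.fourier_coe]
    exact SchwartzMap.continuous _
  have hsum : HasSum (fun n : ℕ ↦ (a ^ n / (n.factorial : ℂ)) * iteratedDeriv n (⇑u) τ)
      (∫ ξ : ℝ, Complex.exp (2 * (π : ℂ) * Complex.I * ((τ : ℂ) + a) * (ξ : ℂ)) *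
        𝓕 (⇑u) ξ) := by
    convert hasSum_integral_exp_mul_of_hasCompactSupport
      (g := fun ξ : ℝ ↦ Complex.exp (2 * (π : ℂ) * Complex.I * τ * ξ) * 𝓕 (⇑u) ξ)
      (by fun_prop) hsupp.mul_left (2 * (π : ℂ) * Complex.I * a) using 1
    · ext n
      rw [u.iteratedDeriv_eq_integral_fourier, ← integral_const_mul]
      congr with ξ
      ring
    · congr with ξ
      rw [← mul_assoc, ← Complex.exp_add]
      ring_nf
  exact ⟨hsum.summable.norm, hsum.tsum_eq⟩
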